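/- For each slot k ∈ S∖{1} and all pairwise distinct teams i,j,i',j' ∈ V there exist tournaments T and T' with (1,i,j), (1,i',j'), (k,i,j'), (k,i',j) ∈ T and T' = T ∖ {(1,i,j),(1,i',j'),(k,i,j'),(k,i',j)} ∪ {(1,i,j'),(1,i',j),(k,i,j),(k,i',j')}; in particular there exists a tournament containing the four matches (1,i,j), (1,i',j'), (k,i,j'), (k,i',j). -/

import Mathlib

open Finset

attribute [local instance] Classical.propDecidable

namespace TTP

/-- `(k,i,j)` is a valid match index: slot `k ∈ S = {1,…,2n-2}`, home venue `i` and
away team `j` are distinct elements of `V = {1,…,n}`. -/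
def IsMatch (n : ℕ) (m : ℕ × ℕ × ℕ) : Prop :=
  1 ≤ m.1 ∧ m.1 ≤ 2 * n - 2 ∧ 1 ≤ m.2.1 ∧ m.2.1 ≤ n ∧ 1 ≤ m.2.2 ∧ m.2.2 ≤ n ∧ m.2.1 ≠ m.2.2

/-- `(t,i,j)` is a valid travel index: `t ∈ V` and `(i,j) ∈ A`. -/
def IsTravelIdx (n : ℕ) (p : ℕ × ℕ × ℕ) : Prop :=
  1 ≤ p.1 ∧ p.1 ≤ n ∧ 1 ≤ p.2.1 ∧ p.2.1 ≤ n ∧ 1 ≤ p.2.2 ∧ p.2.2 ≤ n ∧ p.2.1 ≠ p.2.2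

/-- A (double round-robin) tournament: a set of matches such that in every slot every team
plays exactly once, and every ordered pair of distinct teams meets exactly once. -/
structure IsTournament (n : ℕ) (T : Set (ℕ × ℕ × ℕ)) : Prop where
  subset : ∀ m ∈ T, IsMatch n m
  slot_team : ∀ k, 1 ≤ k → k ≤ 2 * n - 2 → ∀ t, 1 ≤ t → t ≤ n →
      ∃! m : ℕ × ℕ × ℕ, m ∈ T ∧ m.1 = k ∧ (t = m.2.1 ∨ t = m.2.2)
  pair : ∀ i j, 1 ≤ i → i ≤ n → 1 ≤ j → j ≤ n → i ≠ j → ∃! k : ℕ, (k, i, j) ∈ T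

/-- The venue of team `t` in slot `k`: the home venue of the (unique) match of `t` in
slot `k`, and `t` itself if `t` has no match in slot `k` (in particular in the artificial
slots `0` and `2n-1`). -/
noncomputable def venue (T : Set (ℕ × ℕ × ℕ)) (t k : ℕ) : ℕ :=
  if h : ∃ i, ∃ j, (k, i, j) ∈ T ∧ (t = i ∨ t = j) then h.choose else t

/-- The travel vector `ψ(T)`: `travel n T (t,i,j) = 1` iff for some `0 ≤ k ≤ 2n-2` team `t`
has venue `i` in slot `k` and venue `j` in slot `k+1`. -/
noncomputable def travel (n : ℕ) (T : Set (ℕ × ℕ × ℕ)) (p : ℕ × ℕ × ℕ) : ℝ :=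
  if ∃ k, k ≤ 2 * n - 2 ∧ venue T p.1 k = p.2.1 ∧ venue T p.1 (k + 1) = p.2.2 then 1 else 0

/-- The play vector `χ(T)`: characteristic vector of `T`. -/
noncomputable def play (T : Set (ℕ × ℕ × ℕ)) (m : ℕ × ℕ × ℕ) : ℝ :=
  if m ∈ T then 1 else 0

/-- The ambient space `ℝ^M × ℝ^{V×A}`. -/
abbrev Pt (n : ℕ) :=
  ({m : ℕ × ℕ × ℕ // IsMatch n m} → ℝ) × ({p : ℕ × ℕ × ℕ // IsTravelIdx n p} → ℝ)

/-- The play coordinate `x_{k,i,j}` of a point (0 at invalid indices). -/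
noncomputable def xval {n : ℕ} (z : Pt n) (k i j : ℕ) : ℝ :=
  if h : IsMatch n (k, i, j) then z.1 ⟨(k, i, j), h⟩ else 0

/-- The travel coordinate `y_{t,i,j}` of a point (0 at invalid indices). -/
noncomputable def yval {n : ℕ} (z : Pt n) (t i j : ℕ) : ℝ :=
  if h : IsTravelIdx n (t, i, j) then z.2 ⟨(t, i, j), h⟩ else 0

/-- The unconstrained traveling tournament polytope `Ptt(n)`:
the convex hull of all pairs `(χ(T), y)` with `T` a tournament and `y ∈ {0,1}^{V×A}`,
`y ≥ ψ(T)` componentwise. -/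
def Ptt (n : ℕ) : Set (Pt n) :=
  convexHull ℝ { z : Pt n | ∃ T : Set (ℕ × ℕ × ℕ), IsTournament n T ∧
    (∀ m : {m : ℕ × ℕ × ℕ // IsMatch n m}, z.1 m = play T m.1) ∧
    (∀ p : {p : ℕ × ℕ × ℕ // IsTravelIdx n p}, z.2 p = 0 ∨ z.2 p = 1) ∧
    (∀ p : {p : ℕ × ℕ × ℕ // IsTravelIdx n p}, travel n T p.1 ≤ z.2 p) }

/-- Dimension of the affine hull of a set. -/
noncomputable def adim {n : ℕ} (s : Set (Pt n)) : ℕ :=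
  Module.finrank ℝ (affineSpan ℝ s).direction

/-- A valid inequality `f z ≤ γ` is facet-defining for `Ptt(n)`:
it holds on `Ptt(n)` and its face has dimension `dim Ptt(n) - 1`. -/
def IsFacetLE {n : ℕ} (f : Pt n → ℝ) (γ : ℝ) : Prop :=
  (∀ z ∈ Ptt n, f z ≤ γ) ∧ adim {z ∈ Ptt n | f z = γ} + 1 = adim (Ptt n)

/-- A valid inequality `f z ≥ γ` is facet-defining for `Ptt(n)`:
it holds on `Ptt(n)` and its face has dimension `dim Ptt(n) - 1`. -/
def IsFacetGE {n : ℕ} (f : Pt n → ℝ) (γ : ℝ) : Prop :=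
  (∀ z ∈ Ptt n, γ ≤ f z) ∧ adim {z ∈ Ptt n | f z = γ} + 1 = adim (Ptt n)


/-- The canonical one-factorization of the complete graph on `ℤ/m ∪ {∞}`, as an edge colouring. -/
def circleColor {m : ℕ} : Option (ZMod m) → Option (ZMod m) → ZMod m
  | none, none => 0
  | none, some b => 2 * b
  | some a, none => 2 * a
  | some a, some b => a + b

lemma circleColor_comm {m : ℕ} (x y : Option (ZMod m)) : circleColor x y = circleColor y x := by
  cases x <;> cases y <;> simp [circleColor, add_comm]

lemma existsUnique_circleColor {m : ℕ} (hm : Odd m) (x : Option (ZMod m)) (s : ZMod m) :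
    ∃! y, y ≠ x ∧ circleColor x y = s := by
  have h2 : IsUnit (2 : ZMod m) := by
    have := (ZMod.isUnit_iff_coprime 2 m).2 (Nat.coprime_two_left.2 hm)
    simpa using this
  obtain ⟨v, hv⟩ := h2.exists_right_inv
  cases x with
  | none =>
    refine ⟨some (v * s), ⟨by simp, by simp only [circleColor]; linear_combination s * hv⟩, ?_⟩
    rintro (_ | y) ⟨hy, h⟩
    · exact absurd rfl hy
    · simp only [circleColor] at h
      rw [Option.some_inj]
      linear_combination (-y) * hv + v * h
  | some a =>
    by_cases hs : s = 2 * a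
    · refine ⟨none, ⟨by simp, by simp [circleColor, hs]⟩, ?_⟩
      rintro (_ | y) ⟨hy, h⟩
      · rfl
      · simp only [circleColor] at h
        exact absurd (congrArg some (by linear_combination h + hs)) hy
    · refine ⟨some (s - a), ⟨?_, by simp [circleColor]⟩, ?_⟩
      · intro h
        rw [Option.some_inj] at h
        exact hs (by linear_combination h)
      · rintro (_ | y) ⟨hy, h⟩
        · exact absurd h.symm hs
        · simp only [circleColor] at h
          rw [Option.some_inj]
          linear_combination h

/-- A slot assignment `f` on ordered pairs of teams, under which every team has exactly one
opponent in every slot, defines a tournament. -/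
lemma isTournament_of_slot {n : ℕ} (f : Set.Icc 1 n → Set.Icc 1 n → Set.Icc 1 (2 * n - 2))
    (hne : ∀ a b, a ≠ b → f a b ≠ f b a)
    (hf : ∀ s t, ∃! u, u ≠ t ∧ (f t u = s ∨ f u t = s)) :
    IsTournament n {m | ∃ a b, a ≠ b ∧ m = (↑(f a b), ↑a, ↑b)} where
  subset := by
    rintro _ ⟨a, b, hab, rfl⟩
    exact ⟨(f a b).2.1, (f a b).2.2, a.2.1, a.2.2, b.2.1, b.2.2, by
      simpa [Subtype.ext_iff] using hab⟩
  slot_team := by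
    intro k hk1 hk2 t ht1 ht2
    obtain ⟨u, ⟨hut, hu⟩, huniq⟩ := hf ⟨k, hk1, hk2⟩ ⟨t, ht1, ht2⟩
    have key : ∀ a b, a ≠ b → (f a b : ℕ) = k → (t = a ∨ t = b) →
        (a = ⟨t, ht1, ht2⟩ ∧ b = u) ∨ (a = u ∧ b = ⟨t, ht1, ht2⟩) := by
      rintro a b hab hk (rfl | rfl)
      · exact Or.inl ⟨rfl, huniq b ⟨hab.symm, Or.inl (Subtype.ext hk)⟩⟩
      · exact Or.inr ⟨huniq a ⟨hab, Or.inr (Subtype.ext hk)⟩, rfl⟩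
    have hn := hne _ _ hut
    rcases hu with hu | hu
    · refine ⟨(k, t, u), ⟨⟨_, u, hut.symm, by rw [hu]⟩, rfl, Or.inl rfl⟩, ?_⟩
      rintro _ ⟨⟨a, b, hab, rfl⟩, h1, h2⟩
      rcases key a b hab h1 h2 with ⟨rfl, rfl⟩ | ⟨rfl, rfl⟩
      · simp [hu]
      · exact absurd ((Subtype.ext h1).trans hu.symm) hn
    · refine ⟨(k, u, t), ⟨⟨u, _, hut, by rw [hu]⟩, rfl, Or.inr rfl⟩, ?_⟩
      rintro _ ⟨⟨a, b, hab, rfl⟩, h1, h2⟩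
      rcases key a b hab h1 h2 with ⟨rfl, rfl⟩ | ⟨rfl, rfl⟩
      · exact absurd (hu.trans (Subtype.ext h1).symm) hn
      · simp [hu]
  pair := by
    intro i j hi1 hin hj1 hjn hij
    refine ⟨f ⟨i, hi1, hin⟩ ⟨j, hj1, hjn⟩, ⟨_, _, fun h => hij (congrArg Subtype.val h), rfl⟩, ?_⟩
    rintro k ⟨a, b, hab, h⟩
    simp only [Prod.mk.injEq] at h
    obtain ⟨rfl, rfl, rfl⟩ := h
    rfl

/-- Any two injective families of the same size in equinumerous finite types are matched by
some bijection. -/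
lemma exists_equiv_apply_eq {α β ι : Type*} [Finite α] [Finite β] (h : Nat.card α = Nat.card β)
    {f : ι → α} {g : ι → β} (hf : Function.Injective f) (hg : Function.Injective g) :
    ∃ e : α ≃ β, ∀ x, e (f x) = g x := by
  obtain ⟨e₀⟩ := Finite.card_eq.1 h
  have := Fintype.ofFinite β
  let e := ((Equiv.ofInjective _ (e₀.injective.comp hf)).symm.trans
    (Equiv.ofInjective g hg)).extendSubtype
  refine ⟨e₀.trans e, fun x => ?_⟩
  have hx : e₀ (f x) ∈ Set.range (e₀ ∘ f) := ⟨x, rfl⟩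
  have : (⟨e₀ (f x), hx⟩ : Set.range (e₀ ∘ f)) = Equiv.ofInjective _ (e₀.injective.comp hf) x := rfl
  simp only [e, Equiv.trans_apply]
  rw [Equiv.extendSubtype_apply_of_mem _ _ hx, this, Equiv.trans_apply, Equiv.symm_apply_apply,
    Equiv.ofInjective_apply]

/-- Exchanging the slots `k` and `l` on an alternating four-cycle of matches preserves being a
tournament. -/
lemma IsTournament.partialSlotSwap {n : ℕ} {T : Set (ℕ × ℕ × ℕ)} (hT : IsTournament n T)
    {k l i j i' j' : ℕ} (hkl : k ≠ l) (hii' : i ≠ i') (hjj' : j ≠ j')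
    (h₁ : (k, i, j) ∈ T) (h₂ : (k, i', j') ∈ T) (h₃ : (l, i, j') ∈ T) (h₄ : (l, i', j) ∈ T) :
    IsTournament n (T \ {(k, i, j), (k, i', j'), (l, i, j'), (l, i', j)} ∪
        {(k, i, j'), (k, i', j), (l, i, j), (l, i', j')}) := by
  obtain ⟨a1, a2, a3, a4, a5, a6, a7⟩ := hT.subset _ h₁
  obtain ⟨b1, b2, b3, b4, b5, b6, b7⟩ := hT.subset _ h₂
  obtain ⟨c1, c2, c3, c4, c5, c6, c7⟩ := hT.subset _ h₃
  obtain ⟨d1, d2, d3, d4, d5, d6, d7⟩ := hT.subset _ h₄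
  have U : ∀ s a b c d, (s, a, b) ∈ T → (s, c, d) ∈ T → (a = c ∨ a = d ∨ b = c ∨ b = d) →
      a = c ∧ b = d := by
    intro s a b c d h h' ht
    obtain ⟨p1, p2, p3, p4, p5, p6, p7⟩ := hT.subset _ h
    dsimp only at *
    obtain ⟨t, ht, ht', h1, h2⟩ : ∃ t, (t = a ∨ t = b) ∧ (t = c ∨ t = d) ∧ 1 ≤ t ∧ t ≤ n := by
      rcases ht with rfl | rfl | rfl | rfl
      exacts [⟨a, by grind⟩, ⟨a, by grind⟩, ⟨b, by grind⟩, ⟨b, by grind⟩]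
    have := (hT.slot_team s p1 p2 t h1 h2).unique ⟨h, rfl, ht⟩ ⟨h', rfl, ht'⟩
    simpa using this
  have W : ∀ s s' a b, (s, a, b) ∈ T → (s', a, b) ∈ T → s = s' := by
    intro s s' a b h h'
    obtain ⟨p1, p2, p3, p4, p5, p6, p7⟩ := hT.subset _ h
    exact (hT.pair a b p3 p4 p5 p6 p7).unique h h'
  dsimp only at *
  refine ⟨?_, ?_, ?_⟩
  · rintro m (⟨hm, -⟩ | hm)
    · exact hT.subset _ hm
    · simp only [Set.mem_insert_iff, Set.mem_singleton_iff] at hm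
      rcases hm with rfl | rfl | rfl | rfl <;> refine ⟨?_, ?_, ?_, ?_, ?_, ?_, ?_⟩ <;> assumption
  · intro s hs1 hs2 t ht1 ht2
    obtain ⟨⟨s, a, b⟩, ⟨hm, rfl, ht⟩, -⟩ := hT.slot_team s hs1 hs2 t ht1 ht2
    simp only [Set.mem_union, Set.mem_sdiff, Set.mem_insert_iff, Set.mem_singleton_iff]
      at *
    by_cases h : (s = k ∨ s = l) ∧ (t = i ∨ t = i' ∨ t = j ∨ t = j')
    · obtain ⟨rfl | rfl, rfl | rfl | rfl | rfl⟩ := h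
      · exact ⟨(s, t, j'), by grind, by grind⟩
      · exact ⟨(s, t, j), by grind, by grind⟩
      · exact ⟨(s, i', t), by grind, by grind⟩
      · exact ⟨(s, i, t), by grind, by grind⟩
      · exact ⟨(s, t, j), by grind, by grind⟩
      · exact ⟨(s, t, j'), by grind, by grind⟩
      · exact ⟨(s, i, t), by grind, by grind⟩
      · exact ⟨(s, i', t), by grind, by grind⟩
    · exact ⟨(s, a, b), by grind, by grind⟩
  · intro a b ha1 ha2 hb1 hb2 hab
    obtain ⟨s, hs, -⟩ := hT.pair a b ha1 ha2 hb1 hb2 hab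
    simp only [Set.mem_union, Set.mem_sdiff, Set.mem_insert_iff, Set.mem_singleton_iff,
      Prod.mk.injEq] at *
    by_cases h : (a = i ∨ a = i') ∧ (b = j ∨ b = j')
    · exact ⟨Equiv.swap k l s, by grind, by grind⟩
    · refine ⟨s, Or.inl ⟨hs, by grind⟩, ?_⟩
      grind

/-- partial slot swaps exist for every slot `k ∈ S∖{1}` and pairwise
distinct teams `i, j, i', j'`. -/
theorem exists_partial_slot_swap (n : ℕ) (hn : 4 ≤ n) (heven : Even n)
    (k : ℕ) (hk1 : 1 ≤ k) (hk2 : k ≤ 2 * n - 2) (hk3 : k ≠ 1)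
    (i j i' j' : ℕ)
    (hi1 : 1 ≤ i) (hin : i ≤ n) (hj1 : 1 ≤ j) (hjn : j ≤ n)
    (hi'1 : 1 ≤ i') (hi'n : i' ≤ n) (hj'1 : 1 ≤ j') (hj'n : j' ≤ n)
    (hij : i ≠ j) (hii' : i ≠ i') (hij' : i ≠ j') (hji' : j ≠ i') (hjj' : j ≠ j')
    (hi'j' : i' ≠ j') :
    ∃ T T' : Set (ℕ × ℕ × ℕ), IsTournament n T ∧ IsTournament n T' ∧
      (1, i, j) ∈ T ∧ (1, i', j') ∈ T ∧ (k, i, j') ∈ T ∧ (k, i', j) ∈ T ∧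
      T' = T \ {(1, i, j), (1, i', j'), (k, i, j'), (k, i', j)} ∪
        {(1, i, j'), (1, i', j), (k, i, j), (k, i', j')} := by
  suffices h : ∃ T, IsTournament n T ∧
      (1, i, j) ∈ T ∧ (1, i', j') ∈ T ∧ (k, i, j') ∈ T ∧ (k, i', j) ∈ T by
    obtain ⟨T, hT, h₁, h₂, h₃, h₄⟩ := h
    exact ⟨T, _, hT, hT.partialSlotSwap hk3.symm hii' hjj' h₁ h₂ h₃ h₄, h₁, h₂, h₃, h₄, rfl⟩
  obtain ⟨m, rfl⟩ : ∃ m, n = m + 1 := ⟨n - 1, by omega⟩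
  have hm : Odd m := by grind
  have : NeZero m := ⟨by omega⟩
  have : Fact (1 < m) := ⟨by omega⟩
  have hneg : (1 : ZMod m) ≠ -1 := by
    have : Fact (2 < m) := ⟨by omega⟩
    exact (ZMod.neg_one_ne_one).symm
  let vi : Set.Icc 1 (m + 1) := ⟨i, hi1, hin⟩
  let vj : Set.Icc 1 (m + 1) := ⟨j, hj1, hjn⟩
  let vi' : Set.Icc 1 (m + 1) := ⟨i', hi'1, hi'n⟩
  let vj' : Set.Icc 1 (m + 1) := ⟨j', hj'1, hj'n⟩
  have nij : vi ≠ vj := fun h => hij (congrArg Subtype.val h)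
  have nii' : vi ≠ vi' := fun h => hii' (congrArg Subtype.val h)
  have nij' : vi ≠ vj' := fun h => hij' (congrArg Subtype.val h)
  have nji' : vj ≠ vi' := fun h => hji' (congrArg Subtype.val h)
  have njj' : vj ≠ vj' := fun h => hjj' (congrArg Subtype.val h)
  have ni'j' : vi' ≠ vj' := fun h => hi'j' (congrArg Subtype.val h)
  obtain ⟨π, hπ⟩ := exists_equiv_apply_eq (α := Set.Icc 1 (m + 1)) (β := Option (ZMod m))
    (f := ![vi, vj, vi', vj']) (g := ![none, some 0, some 1, some (-1)])
    (by simp)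
    (by intro a b; fin_cases a <;> fin_cases b <;> simp_all [Ne.symm])
    (by intro a b; fin_cases a <;> fin_cases b <;> simp_all [eq_comm])
  obtain ⟨e, he⟩ := exists_equiv_apply_eq (α := ZMod m ⊕ ZMod m) (β := Set.Icc 1 (2 * (m + 1) - 2))
    (f := ![.inl 0, .inr 0]) (g := ![⟨1, le_rfl, by omega⟩, ⟨k, hk1, hk2⟩])
    (by simp; omega)
    (by intro a b; fin_cases a <;> fin_cases b <;> simp)
    (by intro a b; fin_cases a <;> fin_cases b <;> simp [Subtype.ext_iff, hk3, hk3.symm])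
  have hπi : π vi = none := hπ 0
  have hπj : π vj = some 0 := hπ 1
  have hπi' : π vi' = some 1 := hπ 2
  have hπj' : π vj' = some (-1) := hπ 3
  have he1 : e (.inl 0) = ⟨1, le_rfl, by omega⟩ := he 0
  have hek : e (.inr 0) = ⟨k, hk1, hk2⟩ := he 1
  clear hπ he
  let ρ := (Equiv.swap vj vj').trans π
  have hρi : ρ vi = none := by simp [ρ, Equiv.swap_apply_of_ne_of_ne, *]
  have hρj : ρ vj = some (-1) := by simp [ρ, *]
  have hρi' : ρ vi' = some 1 := by
    simp [ρ, Equiv.swap_apply_of_ne_of_ne nji'.symm ni'j', *]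
  have hρj' : ρ vj' = some 0 := by simp [ρ, *]
  obtain ⟨O, hO, hO₁, hO₂, hO₃, hO₄⟩ : ∃ O : Set.Icc 1 (m + 1) → Set.Icc 1 (m + 1) → Prop,
      (∀ a b, a ≠ b → (O a b ↔ ¬ O b a)) ∧ O vi vj ∧ O vi' vj' ∧ ¬ O vi vj' ∧ ¬ O vi' vj := by
    let C : Set.Icc 1 (m + 1) → Set.Icc 1 (m + 1) → Prop := fun a b =>
      (a = vi ∧ b = vj) ∨ (a = vj ∧ b = vi') ∨ (a = vi' ∧ b = vj') ∨ (a = vj' ∧ b = vi)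
    refine ⟨fun a b => C a b ∨ (¬ C b a ∧ a < b), ?_, ?_, ?_, ?_, ?_⟩
    · intro a b hab
      have : C a b → ¬ C b a := by grind
      have : a < b ↔ ¬ b < a := by
        rw [not_lt]; exact ⟨le_of_lt, fun h => lt_of_le_of_ne h hab⟩
      grind
    all_goals grind
  clear_value ρ
  let c : Set.Icc 1 (m + 1) → Set.Icc 1 (m + 1) → ZMod m ⊕ ZMod m := fun a b =>
    if O a b then .inl (circleColor (π a) (π b)) else .inr (circleColor (ρ a) (ρ b))
  have pull : ∀ (τ : Set.Icc 1 (m + 1) ≃ Option (ZMod m)) (s : ZMod m) (t : Set.Icc 1 (m + 1)),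
      ∃! u, u ≠ t ∧ circleColor (τ t) (τ u) = s := fun τ s t => by
    have := (τ.existsUnique_congr_right).2 (existsUnique_circleColor hm (τ t) s)
    simpa using this
  have hc : ∀ s t, ∃! u, u ≠ t ∧ (c t u = s ∨ c u t = s) := by
    rintro (s | s) t
    · refine (existsUnique_congr fun u => and_congr_right fun hu => ?_).1 (pull π s t)
      have := hO t u hu.symm
      have := circleColor_comm (π t) (π u)
      by_cases h : O t u <;> grind
    · refine (existsUnique_congr fun u => and_congr_right fun hu => ?_).1 (pull ρ s t)
      have := hO t u hu.symm
      have := circleColor_comm (ρ t) (ρ u)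
      by_cases h : O t u <;> grind
  refine ⟨_, isTournament_of_slot (fun a b => e (c a b)) ?_ ?_, ⟨vi, vj, nij, ?_⟩,
    ⟨vi', vj', ni'j', ?_⟩, ⟨vi, vj', nij', ?_⟩, ⟨vi', vj, nji'.symm, ?_⟩⟩
  · intro a b hab h
    have := hO a b hab
    have := e.injective h
    grind
  · intro s t
    simpa only [e.eq_symm_apply] using hc (e.symm s) t
  · simp [c, hO₁, hπi, hπj, circleColor, he1, vi, vj]
  · simp [c, hO₂, hπi', hπj', circleColor, he1, vi', vj']
  · simp [c, hO₃, hρi, hρj', circleColor, hek, vi, vj']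
  · simp [c, hO₄, hρi', hρj, circleColor, hek, vi', vj]

end TTP
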